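/- arXiv:2508.08494 — 3 statements merged into one kernel-verified Lean document; each statement's English description precedes it below -/
import Mathlib

section
/- Let N be a positive even integer. Then there exists a vector v = (v_0, …, v_N) ∈ ℚ^{N+1} with T_N v = v and v_N = 1 whose generating function satisfies ∑_{k=0}^N v_k z^{N−k} = P_N(z)·Q_N(z) as polynomials in z; moreover v is the unique vector in ℂ^{N+1} satisfying T_N v = v and v_N = 1. -/
open Polynomial Finset

noncomputable section

/-- The rising Pochhammer symbol `(q)_k = q(q+1)⋯(q+k-1)` over `ℚ`. -/
def poch (q : ℚ) (k : ℕ) : ℚ := (ascPochhammer ℚ k).eval q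

/-- Coefficient of `z^k` in `P_N(z) = ₂F₁(-N/2, N/2+1; -N; z)`. -/
def Pcoef (N k : ℕ) : ℚ :=
  poch (-(N : ℚ) / 2) k * poch ((N : ℚ) / 2 + 1) k /
    (poch (-(N : ℚ)) k * (Nat.factorial k : ℚ))

/-- Coefficient of `z^k` in `Q_N(z) = ₂F₁(-N/2, -3N/2-1; -N; z)`. -/
def Qcoef (N k : ℕ) : ℚ :=
  poch (-(N : ℚ) / 2) k * poch (-(3 * (N : ℚ)) / 2 - 1) k /
    (poch (-(N : ℚ)) k * (Nat.factorial k : ℚ))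

/-- The polynomial `P_N(z)`. -/
def Ppoly (N : ℕ) : ℚ[X] := ∑ k ∈ Finset.range (N / 2 + 1), C (Pcoef N k) * X ^ k

/-- The polynomial `Q_N(z)`. -/
def Qpoly (N : ℕ) : ℚ[X] := ∑ k ∈ Finset.range (N / 2 + 1), C (Qcoef N k) * X ^ k

/-- The `(N+1) × (N+1)` symmetric Pascal matrix, with entries `binom(j+k, j)`. -/
def pascalMatrix (R : Type*) [Semiring R] (N : ℕ) :
    Matrix (Fin (N + 1)) (Fin (N + 1)) R :=
  fun j k => (Nat.choose ((j : ℕ) + (k : ℕ)) (j : ℕ) : R)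


/-- The order three substitution on polynomials of degree at most `d`. -/
def subS {k : Type*} [Field k] (d : ℕ) (f : k[X]) : k[X] := (reflect d f).comp (1 - X)

section S
variable {k : Type*} [Field k]

lemma subS_mul {a b : ℕ} {f g : k[X]} (hf : f.natDegree ≤ a) (hg : g.natDegree ≤ b) :
    subS (a + b) (f * g) = subS a f * subS b g := by
  unfold subS
  rw [reflect_mul f g hf hg, mul_comp]

lemma subS_sub (d : ℕ) (f g : k[X]) : subS d (f - g) = subS d f - subS d g := by
  simp [subS, reflect_sub]

lemma subS_add (d : ℕ) (f g : k[X]) : subS d (f + g) = subS d f + subS d g := by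
  simp [subS, reflect_add]

lemma subS_C_mul (d : ℕ) (c : k) (f : k[X]) : subS d (C c * f) = C c * subS d f := by
  simp [subS, reflect_C_mul]

lemma subS_one (d : ℕ) : subS d (1 : k[X]) = (1 - X) ^ d := by
  have : reflect d (1 : k[X]) = X ^ d := by
    have := reflect_C (1 : k) d
    simpa using this
  simp [subS, this]

lemma subS_X_pow (d i : ℕ) (h : i ≤ d) : subS d (X ^ i : k[X]) = (1 - X) ^ (d - i) := by
  have : reflect d (X ^ i : k[X]) = X ^ (d - i) := by
    have := reflect_monomial (R := k) d i
    rw [this, revAt_le h]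
  simp [subS, this]

lemma natDegree_one_sub_X : (1 - X : k[X]).natDegree = 1 := by
  have h : (1 - X : k[X]) = -(X - C 1) := by simp
  rw [h, natDegree_neg, natDegree_X_sub_C]

lemma natDegree_one_sub_X_pow (n : ℕ) : ((1 - X : k[X]) ^ n).natDegree = n := by
  rw [natDegree_pow, natDegree_one_sub_X, mul_one]

lemma subS_natDegree_le {d : ℕ} {f : k[X]} (hf : f.natDegree ≤ d) :
    (subS d f).natDegree ≤ d := by
  unfold subS
  rw [natDegree_comp, natDegree_one_sub_X, mul_one, natDegree_le_iff_coeff_eq_zero]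
  intro i hi
  rw [coeff_reflect, revAt_eq_self_of_lt hi]
  exact coeff_eq_zero_of_natDegree_lt (lt_of_le_of_lt hf hi)

lemma subS_one_sub_X_pow (n : ℕ) : subS n ((1 - X : k[X]) ^ n) = (-X) ^ n := by
  induction n with
  | zero => simpa using subS_one (k := k) 0
  | succ n ih =>
    rw [pow_succ, subS_mul (natDegree_one_sub_X_pow n).le natDegree_one_sub_X.le, ih, pow_succ,
      subS_sub, subS_one]
    have := subS_X_pow (k := k) 1 1 le_rfl
    rw [pow_one] at this
    rw [this]; simp

lemma subS_cube_X_pow (d i : ℕ) (h : i ≤ d) :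
    subS d (subS d (subS d (X ^ i : k[X]))) = (-1) ^ d * X ^ i := by
  obtain ⟨e, rfl⟩ := Nat.exists_eq_add_of_le h
  have e1 : subS (i + e) (X ^ i : k[X]) = 1 * (1 - X) ^ e := by
    rw [subS_X_pow _ _ h]; simp
  rw [e1, subS_mul (by simp) (natDegree_one_sub_X_pow e).le, subS_one, subS_one_sub_X_pow,
    subS_mul (natDegree_one_sub_X_pow i).le, subS_one_sub_X_pow]
  · have : ((-X) ^ e : k[X]) = C ((-1) ^ e) * X ^ e := by
      rw [neg_pow]; simp
    rw [this, subS_C_mul, subS_X_pow _ _ le_rfl, neg_pow]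
    simp; ring
  · rw [natDegree_pow]; simp

lemma subS_sum {ι : Type*} (s : Finset ι) (d : ℕ) (f : ι → k[X]) :
    subS d (∑ i ∈ s, f i) = ∑ i ∈ s, subS d (f i) := by
  classical
  induction s using Finset.induction_on with
  | empty => simp [subS]
  | insert a s ha ih => rw [sum_insert ha, sum_insert ha, subS_add, ih]

lemma subS_cube {d : ℕ} {f : k[X]} (hf : f.natDegree ≤ d) :
    subS d (subS d (subS d f)) = (-1) ^ d * f := by
  rw [f.as_sum_range_C_mul_X_pow' (n := d + 1) (by omega)]
  simp only [subS_sum, subS_C_mul, mul_sum]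
  refine sum_congr rfl fun i hi => ?_
  rw [subS_cube_X_pow _ _ (by simp at hi; omega)]
  ring

lemma subS_map {l : Type*} [Field l] (φ : k →+* l) (d : ℕ) (f : k[X]) :
    subS d (f.map φ) = (subS d f).map φ := by
  simp [subS, Polynomial.map_comp, reflect_map]

end S

section pade
variable {k : Type*} [Field k]

lemma coprime_X_one_sub : IsCoprime (X : k[X]) (1 - X) := ⟨1, 1, by ring⟩

lemma coprime_of_eval_zero {f : k[X]} (h : f.eval 0 ≠ 0) : IsCoprime f X := by
  have := (irreducible_X (R := k)).coprime_iff_not_dvd.2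
    (fun hd : _ ∣ f => h (by rw [X_dvd_iff] at hd; rwa [← coeff_zero_eq_eval_zero]))
  exact this.symm

lemma coprime_of_eval_one {f : k[X]} (h : f.eval 1 ≠ 0) : IsCoprime f (1 - X) := by
  have := (irreducible_X_sub_C (1 : k)).coprime_iff_not_dvd.2
    (fun hd : _ ∣ f => h (by rwa [dvd_iff_isRoot] at hd))
  have h2 : (1 - X : k[X]) = -(X - C 1) := by simp
  rw [h2]
  exact this.symm.neg_right

lemma pade_unique {m : ℕ} {A B C₁ A' B' C' : k[X]}
    (h : A - X ^ (2 * m + 1) * B - (1 - X) ^ (2 * m + 1) * C₁ = 0)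
    (h' : A' - X ^ (2 * m + 1) * B' - (1 - X) ^ (2 * m + 1) * C' = 0)
    (hA : A.natDegree ≤ m) (hC : C₁.natDegree ≤ m) (hA' : A'.natDegree ≤ m)
    (hC' : C'.natDegree ≤ m) : A * C' = A' * C₁ := by
  have e : A * C' - A' * C₁ = X ^ (2 * m + 1) * (B * C' - B' * C₁) := by
    linear_combination C' * h - C₁ * h'
  have hd : (A * C' - A' * C₁).natDegree < (X ^ (2 * m + 1) : k[X]).natDegree := by
    rw [natDegree_X_pow]
    have h1 := natDegree_sub_le (A * C') (A' * C₁)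
    have h2 := natDegree_mul_le (p := A) (q := C')
    have h3 := natDegree_mul_le (p := A') (q := C₁)
    have : max (A * C').natDegree (A' * C₁).natDegree ≤ 2 * m := max_le (by omega) (by omega)
    omega
  exact sub_eq_zero.1 (eq_zero_of_dvd_of_natDegree_lt ⟨_, e⟩ hd)

/-- natural degree bound for the quotient -/
lemma natDegree_le_of_mul {p q : k[X]} {a b : ℕ} (hp : p.natDegree = a) (hp0 : p ≠ 0)
    (h : (p * q).natDegree ≤ a + b) : q.natDegree ≤ b := by
  by_cases hq : q = 0
  · simp [hq]
  · rw [natDegree_mul hp0 hq] at h; omega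

lemma one_sub_X_ne : (1 - X : k[X]) ≠ 0 := by
  intro h
  have := natDegree_one_sub_X (k := k)
  rw [h] at this; simp at this

lemma coprime_AC [CharZero k] {m : ℕ} (hm : 0 < m) {A B C₁ : k[X]}
    (h : A - X ^ (2 * m + 1) * B - (1 - X) ^ (2 * m + 1) * C₁ = 0)
    (hA : A.natDegree = m) (hC : C₁.natDegree = m)
    (hC0 : C₁.eval 0 ≠ 0) (hC1 : C₁.eval 1 ≠ 0) : IsCoprime A C₁ := by
  have hA0 : A ≠ 0 := by rintro rfl; simp at hA; omega
  have hC00 : C₁ ≠ 0 := by rintro rfl; simp at hC; omega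
  set Y : k[X] := (1 - X) ^ (2 * m + 1) * C₁ with hY
  have hYd : Y.natDegree = 3 * m + 1 := by
    rw [hY, natDegree_mul (pow_ne_zero _ one_sub_X_ne) hC00, natDegree_one_sub_X_pow, hC]; ring
  have hY0 : Y ≠ 0 := mul_ne_zero (pow_ne_zero _ one_sub_X_ne) hC00
  set W : k[X] := A * derivative Y - derivative A * Y with hW
  have hY' : (derivative Y).natDegree ≤ 3 * m := by
    have := natDegree_derivative_le Y; omega
  have hA' : (derivative A).natDegree ≤ m - 1 := by
    have := natDegree_derivative_le A; omega
  have hWd : W.natDegree ≤ 4 * m := by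
    have h1 := natDegree_sub_le (A * derivative Y) (derivative A * Y)
    have h2 := natDegree_mul_le (p := A) (q := derivative Y)
    have h3 := natDegree_mul_le (p := derivative A) (q := Y)
    have : max (A * derivative Y).natDegree (derivative A * Y).natDegree ≤ 4 * m :=
      max_le (by omega) (by omega)
    rw [hW]
    omega
  have hWc : W.coeff (4 * m) = A.leadingCoeff * Y.leadingCoeff * (2 * m + 1) := by
    rw [hW, coeff_sub]
    have e1 : (A * derivative Y).coeff (m + 3 * m) = A.coeff m * (derivative Y).coeff (3 * m) :=
      coeff_mul_add_eq_of_natDegree_le hA.le hY'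
    have e2 : (derivative A * Y).coeff ((m - 1) + (3 * m + 1))
        = (derivative A).coeff (m - 1) * Y.coeff (3 * m + 1) :=
      coeff_mul_add_eq_of_natDegree_le hA' hYd.le
    rw [show m + 3 * m = 4 * m by ring] at e1
    rw [show (m - 1) + (3 * m + 1) = 4 * m by omega] at e2
    rw [e1, e2, coeff_derivative, coeff_derivative, leadingCoeff, leadingCoeff, hA, hYd,
      show m - 1 + 1 = m by omega, Nat.cast_sub (by omega : 1 ≤ m)]
    push_cast
    ring
  have hW0 : W ≠ 0 := by
    intro h0
    rw [h0, coeff_zero] at hWc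
    have : (2 * m + 1 : k) ≠ 0 := by exact_mod_cast Nat.succ_ne_zero (2 * m)
    exact mul_ne_zero (mul_ne_zero (leadingCoeff_ne_zero.2 hA0) (leadingCoeff_ne_zero.2 hY0)) this
      hWc.symm
  have d1 : (1 - X : k[X]) ^ (2 * m) ∣ W := by
    refine ⟨A * (-(2 * (m : k[X]) + 1) * C₁ + (1 - X) * derivative C₁) - derivative A * (1 - X) * C₁, ?_⟩
    rw [hW, hY]
    simp only [derivative_mul, derivative_pow, derivative_sub, derivative_one, derivative_X]
    simp [map_ofNat C 2]
    ring
  have hYX : Y = A - X ^ (2 * m + 1) * B := by linear_combination -h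
  have d2 : (X : k[X]) ^ (2 * m) ∣ W := by
    refine ⟨-A * ((2 * (m : k[X]) + 1) * B + X * derivative B) + derivative A * X * B, ?_⟩
    rw [hW, hYX]
    simp only [derivative_mul, derivative_pow, derivative_sub, derivative_X]
    simp [map_ofNat C 2]
    ring
  obtain ⟨E, hE⟩ := (coprime_X_one_sub (k := k)).pow.mul_dvd d2 d1
  have hEd : E.natDegree ≤ 0 := by
    refine natDegree_le_of_mul (p := X ^ (2 * m) * (1 - X) ^ (2 * m)) (a := 4 * m) ?_ ?_ ?_
    · rw [natDegree_mul (pow_ne_zero _ X_ne_zero) (pow_ne_zero _ one_sub_X_ne), natDegree_X_pow,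
        natDegree_one_sub_X_pow]; ring
    · exact mul_ne_zero (pow_ne_zero _ X_ne_zero) (pow_ne_zero _ one_sub_X_ne)
    · rw [← hE]; simpa using hWd
  have hE0 : E ≠ 0 := by rintro rfl; simp at hE; exact hW0 hE
  have hEu : IsUnit E := by
    rw [natDegree_eq_zero_iff_degree_le_zero.1 (Nat.le_zero.1 hEd) |> eq_C_of_degree_le_zero]
    refine isUnit_C.2 (isUnit_iff_ne_zero.2 fun h0 => hE0 ?_)
    rw [eq_C_of_natDegree_le_zero hEd, h0, C_0]
  have c1 : IsCoprime C₁ W := by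
    rw [hE]
    refine IsCoprime.mul_right (IsCoprime.mul_right ?_ ?_) ?_
    · exact (coprime_of_eval_zero hC0).pow_right
    · exact (coprime_of_eval_one hC1).pow_right
    · obtain ⟨u, hu⟩ := hEu
      exact ⟨0, ↑u⁻¹, by rw [← hu]; simp⟩
  have e3 : W = A * derivative Y + C₁ * (-derivative A * (1 - X) ^ (2 * m + 1)) := by
    rw [hW, hY]; ring
  rw [e3] at c1
  exact (IsCoprime.of_mul_right_left (IsCoprime.of_add_mul_left_right c1)).symm

end pade

section sys

/-- The relations satisfied by the three Padé polynomials. -/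
structure PadeSys (k : Type*) [Field k] (m : ℕ) (A B C₁ : k[X]) : Prop where
  rel : A - X ^ (2 * m + 1) * B - (1 - X) ^ (2 * m + 1) * C₁ = 0
  dA : A.natDegree = m
  dB : B.natDegree ≤ m
  dC : C₁.natDegree = m
  sA : subS m A = (-1) ^ m * C₁
  sB : subS m B = (-1) ^ m * A
  sC : subS m C₁ = (-1) ^ m * B
  cop : IsCoprime A C₁
  A0 : A.eval 0 = 1
  C0 : C₁.eval 0 = 1

lemma padeSys_of {m : ℕ} (hm : 0 < m) {A C₁ : ℚ[X]}
    (h : X ^ (2 * m + 1) ∣ A - (1 - X) ^ (2 * m + 1) * C₁)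
    (hA : A.natDegree = m) (hC : C₁.natDegree = m)
    (hA0 : A.eval 0 = 1) (hC0 : C₁.eval 0 = 1) (hC1 : C₁.eval 1 ≠ 0) :
    ∃ B, PadeSys ℚ m A B C₁ := by
  obtain ⟨B, hB⟩ := h
  have rel : A - X ^ (2 * m + 1) * B - (1 - X) ^ (2 * m + 1) * C₁ = 0 := by
    linear_combination hB
  have hAz : A ≠ 0 := by rintro rfl; simp at hA; omega
  have hCz : C₁ ≠ 0 := by rintro rfl; simp at hC; omega
  have dB : B.natDegree ≤ m := by
    refine natDegree_le_of_mul (p := X ^ (2 * m + 1)) (a := 2 * m + 1) (natDegree_X_pow _)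
      (pow_ne_zero _ X_ne_zero) ?_
    rw [← hB]
    have h1 := natDegree_sub_le A ((1 - X) ^ (2 * m + 1) * C₁)
    have h2 := natDegree_mul_le (p := (1 - X : ℚ[X]) ^ (2 * m + 1)) (q := C₁)
    rw [natDegree_one_sub_X_pow] at h2
    have : max A.natDegree ((1 - X) ^ (2 * m + 1) * C₁).natDegree ≤ 2 * m + 1 + m :=
      max_le (by omega) (by omega)
    omega
  have cop := coprime_AC hm rel hA hC (by rw [hC0]; exact one_ne_zero) hC1
  have rel2 : subS m B - X ^ (2 * m + 1) * subS m C₁ - (1 - X) ^ (2 * m + 1) * subS m A = 0 := by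
    have := congrArg (subS (2 * m + 1 + m)) rel
    rw [subS_sub, subS_sub, subS_mul (natDegree_X_pow_le _) dB,
      subS_mul (natDegree_one_sub_X_pow _).le hC.le, subS_X_pow _ _ le_rfl,
      subS_one_sub_X_pow] at this
    have e : subS (2 * m + 1 + m) A = (1 - X) ^ (2 * m + 1) * subS m A := by
      have := subS_mul (k := ℚ) (a := 2 * m + 1) (f := 1) (by simp) hA.le
      rwa [one_mul, subS_one] at this
    rw [e] at this
    have e0 : subS (2 * m + 1 + m) (0 : ℚ[X]) = 0 := by simp [subS]
    have e1 : (-X : ℚ[X]) ^ (2 * m + 1) = - X ^ (2 * m + 1) := Odd.neg_pow ⟨m, rfl⟩ _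
    rw [e0, e1] at this
    simp at this
    linear_combination -this
  have p := pade_unique rel rel2 hA.le hC.le (subS_natDegree_le dB) (subS_natDegree_le hA.le)
  obtain ⟨E, hE⟩ : C₁ ∣ subS m A := cop.symm.dvd_of_dvd_mul_left ⟨subS m B, by rw [p]; ring⟩
  have hEd : E.natDegree ≤ 0 := by
    refine natDegree_le_of_mul hC hCz ?_
    rw [← hE]; simpa using subS_natDegree_le hA.le
  obtain ⟨κ, rfl⟩ : ∃ κ, E = C κ := ⟨_, eq_C_of_natDegree_le_zero hEd⟩
  have hSA : subS m A = C κ * C₁ := by rw [hE]; ring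
  have hSB : subS m B = C κ * A := by
    apply mul_right_cancel₀ hCz
    rw [← p, hSA]; ring
  have hSC : subS m C₁ = C κ * B := by
    apply mul_left_cancel₀ (pow_ne_zero (2 * m + 1) (X_ne_zero (R := ℚ)))
    rw [hSA, hSB] at rel2
    linear_combination C κ * rel - rel2
  have hκ : κ = (-1) ^ m := by
    have h3 := subS_cube (k := ℚ) hA.le
    rw [hSA, subS_C_mul, hSC, subS_C_mul, subS_C_mul, hSB] at h3
    have h4 := congrArg (eval 0) h3
    simp [hA0] at h4
    have h5 : κ ^ 3 = ((-1) ^ m) ^ 3 := by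
      have : ((-1 : ℚ) ^ m) ^ 3 = (-1) ^ m := by
        rw [← pow_mul, mul_comm, pow_mul]; norm_num
      rw [this, ← h4]; ring
    exact (Odd.strictMono_pow (by decide : Odd 3)).injective h5
  have hCκ : (C κ : ℚ[X]) = (-1) ^ m := by rw [hκ]; simp
  rw [hCκ] at hSA hSB hSC
  exact ⟨B, rel, hA, dB, hC, hSA, hSB, hSC, cop, hA0, hC0⟩

variable {k : Type*} [Field k]

lemma PadeSys.map {l : Type*} [Field l] (φ : k →+* l) {m : ℕ} {A B C₁ : k[X]}
    (h : PadeSys k m A B C₁) : PadeSys l m (A.map φ) (B.map φ) (C₁.map φ) where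
  rel := by simpa using congrArg (Polynomial.map φ) h.rel
  dA := by rw [natDegree_map, h.dA]
  dB := by rw [natDegree_map]; exact h.dB
  dC := by rw [natDegree_map, h.dC]
  sA := by rw [subS_map, h.sA]; simp
  sB := by rw [subS_map, h.sB]; simp
  sC := by rw [subS_map, h.sC]; simp
  cop := h.cop.map (mapRingHom φ)
  A0 := by rw [← map_zero φ, eval_map_apply, h.A0, map_one]
  C0 := by rw [← map_zero φ, eval_map_apply, h.C0, map_one]

lemma eps_sq (m : ℕ) : ((-1 : k[X]) ^ m) * (-1) ^ m = 1 := by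
  rw [← mul_pow]; simp

lemma PadeSys.exists_fixed {m : ℕ} {A B C₁ : k[X]} (h : PadeSys k m A B C₁) :
    (1 - X) ^ (2 * m + 1) ∣ C₁ * A - X ^ (2 * m + 1) * subS (2 * m) (C₁ * A) := by
  refine ⟨C₁ * C₁, ?_⟩
  rw [two_mul, subS_mul h.dC.le h.dA.le, h.sA, h.sC]
  have := eps_sq (k := k) m
  have r := h.rel
  rw [two_mul] at r
  linear_combination C₁ * r - X ^ (m + m + 1) * B * C₁ * this

lemma natDegree_dvd_zero {p q : k[X]} (hd : p ∣ q) (h : q.natDegree < p.natDegree) : q = 0 :=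
  eq_zero_of_dvd_of_natDegree_lt hd h

lemma PadeSys.unique {m : ℕ} (hm : 0 < m) {A B C₁ F : k[X]} (h : PadeSys k m A B C₁)
    (hF : F.natDegree ≤ 2 * m) (hF0 : F.eval 0 = 1)
    (hd : (1 - X) ^ (2 * m + 1) ∣ F - X ^ (2 * m + 1) * subS (2 * m) F) : F = C₁ * A := by
  have hAz : A ≠ 0 := by rintro rfl; have := h.dA; simp at this; omega
  have hCz : C₁ ≠ 0 := by rintro rfl; have := h.dC; simp at this; omega
  have hε := eps_sq (k := k) m
  set ε : k[X] := (-1) ^ m with hεd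
  have hεC : ε = C ((-1) ^ m) := by simp [hεd]
  set n := 2 * m + 1 with hn
  set G2 := subS (2 * m) F with hG2
  set G3 := subS (2 * m) G2 with hG3
  have dG2 : G2.natDegree ≤ 2 * m := subS_natDegree_le hF
  have dG3 : G3.natDegree ≤ 2 * m := subS_natDegree_le dG2
  have hG4 : subS (2 * m) G3 = F := by
    rw [hG3, hG2, subS_cube hF, pow_mul]; simp
  have sA : subS m A = ε * C₁ := h.sA
  have sB : subS m B = ε * A := h.sB
  have sC : subS m C₁ = ε * B := h.sC
  have rel : A - X ^ n * B - (1 - X) ^ n * C₁ = 0 := h.rel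
  have dA := h.dA
  have dB := h.dB
  have dC := h.dC
  have cX : IsCoprime ((1 - X : k[X]) ^ n) (X ^ n) := (coprime_X_one_sub (k := k)).symm.pow
  obtain ⟨H, hH⟩ := hd
  obtain ⟨K, hK⟩ : (1 - X) ^ n ∣ F * B - G2 * A := by
    refine cX.dvd_of_dvd_mul_left ⟨A * H - F * C₁, ?_⟩
    linear_combination A * hH - F * rel
  have dK : K.natDegree ≤ m - 1 := by
    refine natDegree_le_of_mul (natDegree_one_sub_X_pow n) (pow_ne_zero _ one_sub_X_ne) ?_
    rw [← hK]
    have h1 := natDegree_sub_le (F * B) (G2 * A)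
    have h2 := natDegree_mul_le (p := F) (q := B)
    have h3 := natDegree_mul_le (p := G2) (q := A)
    have : max (F * B).natDegree (G2 * A).natDegree ≤ 3 * m := max_le (by omega) (by omega)
    omega
  set K2 := subS (m - 1) K with hK2d
  set K3 := subS (m - 1) K2 with hK3d
  have dK2 : K2.natDegree ≤ m - 1 := subS_natDegree_le dK
  have dK3 : K3.natDegree ≤ m - 1 := subS_natDegree_le dK2
  have e1 : (-X : k[X]) ^ n = - X ^ n := Odd.neg_pow ⟨m, rfl⟩ _
  have hidx : 2 * m + m = n + (m - 1) := by omega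
  have hK2 : ε * (G2 * A - G3 * C₁) = - (X ^ n * K2) := by
    have := congrArg (subS (2 * m + m)) hK
    rw [subS_sub, subS_mul hF dB, subS_mul dG2 dA.le, sA, sB, hidx,
      subS_mul (natDegree_one_sub_X_pow n).le dK, subS_one_sub_X_pow, e1] at this
    linear_combination this
  have hK3 : G3 * C₁ - F * B = - K3 := by
    have h0 : G2 * A - G3 * C₁ = C (-(-1) ^ m) * (X ^ n * K2) := by
      have : (C (-(-1) ^ m) : k[X]) = - ε := by rw [hεC, C_neg]
      rw [this]
      linear_combination ε * hK2 - (G2 * A - G3 * C₁) * hε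
    have := congrArg (subS (2 * m + m)) h0
    rw [subS_sub, subS_mul dG2 dA.le, subS_mul dG3 dC.le, sA, sC, subS_C_mul, hidx,
      subS_mul (natDegree_X_pow_le n) dK2, subS_X_pow _ _ le_rfl, hG4, C_neg, ← hεC] at this
    simp only [Nat.sub_self, pow_zero, one_mul] at this
    linear_combination ε * this - (G3 * C₁ - F * B + K3) * hε
  have relK : K3 - X ^ n * (-ε * K2) - (1 - X) ^ n * K = 0 := by
    linear_combination hK + ε * hK2 + hK3 - (G2 * A - G3 * C₁) * hε
  have pu := pade_unique rel relK dA.le dC.le (by omega) (by omega)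
  have hCK : C₁ ∣ K := h.cop.symm.dvd_of_dvd_mul_left ⟨K3, by rw [pu]; ring⟩
  have hK0 : K = 0 := natDegree_dvd_zero hCK (by omega)
  have hK30 : K3 = 0 := by rw [hK3d, hK2d, hK0]; simp [subS]
  rw [hK0, mul_zero] at hK
  rw [hK30, neg_zero] at hK3
  -- coprimality of the other pairs
  have hA1 : A.eval 1 ≠ 0 := by
    have h1 := congrArg (eval 0) sA
    have h2 : eval 0 (subS m A) = eval 1 A := by
      let _ : Invertible (1 : k) := invertibleOne
      have h3 := eval₂_reflect_mul_pow (RingHom.id k) (1 : k) m A dA.le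
      simp only [invOf_one, one_pow, mul_one] at h3
      simpa [subS, eval_comp] using h3
    rw [h2, eval_mul, h.C0, mul_one] at h1
    rw [h1, hεd]; simp
  have cAB : IsCoprime A B := by
    have c1 : IsCoprime A ((1 - X) ^ n * C₁) :=
      IsCoprime.mul_right (coprime_of_eval_one hA1).pow_right h.cop
    have e2 : (1 - X) ^ n * C₁ = -(X ^ n * B) + A * 1 := by linear_combination -rel
    rw [e2] at c1
    exact ((IsCoprime.neg_right_iff _ _).1 (IsCoprime.of_add_mul_left_right c1)).of_mul_right_right
  have cCB : IsCoprime C₁ B := by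
    have c1 := h.cop.symm
    have e2 : A = X ^ n * B + C₁ * (1 - X) ^ n := by linear_combination rel
    rw [e2] at c1
    exact (IsCoprime.of_add_mul_left_right c1).of_mul_right_right
  have dAF : A ∣ F := cAB.dvd_of_dvd_mul_right ⟨G2, by linear_combination hK⟩
  have dCF : C₁ ∣ F := cCB.dvd_of_dvd_mul_right ⟨G3, by linear_combination -hK3⟩
  obtain ⟨E, hE⟩ := h.cop.symm.mul_dvd dCF dAF
  have hEd : E.natDegree ≤ 0 := by
    refine natDegree_le_of_mul (p := C₁ * A) (a := 2 * m) ?_ (mul_ne_zero hCz hAz) ?_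
    · rw [natDegree_mul hCz hAz]; omega
    · rw [← hE]; simpa using hF
  obtain ⟨κ, rfl⟩ : ∃ κ, E = C κ := ⟨_, eq_C_of_natDegree_le_zero hEd⟩
  rw [hE] at hF0
  simp [h.A0, h.C0] at hF0
  rw [hE, hF0]; simp

end sys

section explicit

lemma poch_succ (q : ℚ) (k : ℕ) : poch q (k + 1) = poch q k * (q + k) := by
  unfold poch; rw [ascPochhammer_succ_eval]

lemma poch_zero (q : ℚ) : poch q 0 = 1 := by simp [poch]

lemma poch_neg_eq_zero {m k : ℕ} (h : m < k) : poch (-(m : ℚ)) k = 0 :=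
  ascPochhammer_eval_neg_coe_nat_of_lt h

lemma poch_neg_ne {m k : ℕ} (h : k ≤ m) : poch (-(m : ℚ)) k ≠ 0 := by
  induction k with
  | zero => simp [poch_zero]
  | succ k ih =>
    rw [poch_succ]
    refine mul_ne_zero (ih (by omega)) ?_
    have : (k : ℚ) < m := by exact_mod_cast h
    linarith

lemma poch_pos {q : ℚ} (hq : 0 < q) (k : ℕ) : 0 < poch q k := by
  induction k with
  | zero => simp [poch_zero]
  | succ k ih => rw [poch_succ]; positivity

/-- general coefficient -/
def hcoef (m : ℕ) (b : ℚ) (k : ℕ) : ℚ :=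
  poch (-(m : ℚ)) k * poch b k / (poch (-((2 * m : ℕ) : ℚ)) k * (Nat.factorial k : ℚ))

lemma Pcoef_eq (m k : ℕ) : Pcoef (2 * m) k = hcoef m (m + 1) k := by
  unfold Pcoef hcoef
  have : (-((2 * m : ℕ) : ℚ) / 2) = -m := by push_cast; ring
  rw [this]
  have : (((2 * m : ℕ) : ℚ) / 2) = m := by push_cast; ring
  rw [this]

lemma Qcoef_eq (m k : ℕ) : Qcoef (2 * m) k = hcoef m (-((3 * m + 1 : ℕ) : ℚ)) k := by
  unfold Qcoef hcoef
  have : (-((2 * m : ℕ) : ℚ) / 2) = -m := by push_cast; ring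
  rw [this]
  have : (-(3 * ((2 * m : ℕ) : ℚ)) / 2 - 1) = -((3 * m + 1 : ℕ) : ℚ) := by push_cast; ring
  rw [this]

lemma hcoef_zero (m : ℕ) (b : ℚ) : hcoef m b 0 = 1 := by simp [hcoef, poch_zero]

lemma hcoef_eq_zero {m k : ℕ} (b : ℚ) (h : m < k) : hcoef m b k = 0 := by
  simp [hcoef, poch_neg_eq_zero h]

lemma hcoef_rec {m : ℕ} (hm : 0 < m) (b : ℚ) (k : ℕ) :
    ((k : ℚ) + 1) * (k - 2 * m) * hcoef m b (k + 1) = (k - m) * (k + b) * hcoef m b k := by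
  by_cases h : m ≤ k
  · rw [hcoef_eq_zero b (by omega : m < k + 1)]
    rcases eq_or_lt_of_le h with h | h
    · rw [h]; simp
    · rw [hcoef_eq_zero b h]; simp
  · unfold hcoef
    rw [poch_succ, poch_succ, poch_succ, Nat.factorial_succ]
    have h1 := poch_neg_ne (m := 2 * m) (k := k) (by omega)
    have h2 : (-((2 * m : ℕ) : ℚ) + k) ≠ 0 := by
      have : (k : ℚ) < m := by exact_mod_cast (not_le.1 h)
      have h0 : (0 : ℚ) < m := by exact_mod_cast hm
      push_cast
      linarith
    have h3 : (Nat.factorial k : ℚ) ≠ 0 := by exact_mod_cast Nat.factorial_ne_zero k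
    have h4 : ((k : ℚ) + 1) ≠ 0 := by positivity
    push_cast at h1 h2 ⊢
    field_simp
    ring

lemma hcoef_ne {m : ℕ} {b : ℚ} (hb : poch b m ≠ 0) : hcoef m b m ≠ 0 := by
  unfold hcoef
  refine div_ne_zero (mul_ne_zero (poch_neg_ne le_rfl) hb)
    (mul_ne_zero (poch_neg_ne (by omega)) ?_)
  exact_mod_cast Nat.factorial_ne_zero m

/-- general polynomial -/
def hpoly (m : ℕ) (b : ℚ) : ℚ[X] := ∑ k ∈ Finset.range (m + 1), C (hcoef m b k) * X ^ k

lemma hpoly_coeff (m : ℕ) (b : ℚ) (k : ℕ) : (hpoly m b).coeff k = hcoef m b k := by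
  unfold hpoly
  simp only [finsetSum_coeff, coeff_C_mul_X_pow]
  rw [Finset.sum_ite_eq]
  split_ifs with h
  · rfl
  · rw [hcoef_eq_zero]; simp at h; omega

lemma hpoly_natDegree {m : ℕ} {b : ℚ} (hb : poch b m ≠ 0) : (hpoly m b).natDegree = m := by
  refine natDegree_eq_of_le_of_coeff_ne_zero ?_ (by rw [hpoly_coeff]; exact hcoef_ne hb)
  rw [natDegree_le_iff_coeff_eq_zero]
  intro k hk
  rw [hpoly_coeff, hcoef_eq_zero b hk]

lemma hpoly_eval_zero (m : ℕ) (b : ℚ) : (hpoly m b).eval 0 = 1 := by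
  rw [← coeff_zero_eq_eval_zero, hpoly_coeff, hcoef_zero]

lemma hcoef_pos {m : ℕ} {b : ℚ} (hb : 0 < b) {k : ℕ} (hk : k ≤ m) : 0 < hcoef m b k := by
  induction k with
  | zero => simp [hcoef_zero]
  | succ k ih =>
    have h1 := ih (by omega)
    have h2 := hcoef_rec (m := m) (by omega) b k
    have hkm : (k : ℚ) < m := by exact_mod_cast hk
    have hk0 : (0 : ℚ) ≤ k := by positivity
    have h3 : hcoef m b (k + 1)
        = ((m - k) * (k + b) * hcoef m b k) / ((k + 1) * (2 * m - k)) := by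
      rw [eq_div_iff (by
        have : (0 : ℚ) < (k + 1) * (2 * m - k) := mul_pos (by linarith) (by linarith)
        exact this.ne')]
      linear_combination -h2
    rw [h3]
    exact div_pos (mul_pos (mul_pos (by linarith) (by linarith)) h1)
      (mul_pos (by linarith) (by linarith))

lemma hpoly_eval_one {m : ℕ} {b : ℚ} (hb : 0 < b) : (hpoly m b).eval 1 ≠ 0 := by
  unfold hpoly
  rw [eval_finsetSum]
  refine (Finset.sum_pos (fun k hk => ?_) ⟨0, by simp⟩).ne'
  simp only [eval_mul, eval_C, eval_pow, eval_X, one_pow, mul_one]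
  exact hcoef_pos hb (by simp at hk; omega)

lemma ode_coeff (α β γ : ℚ) (p : ℚ[X]) (k : ℕ) :
    (X * (1 - X) * derivative (derivative p) + (C α + C β * X) * derivative p + C γ * p).coeff k
      = (k + 1) * (k + α) * p.coeff (k + 1) + (-(k * (k - 1)) + β * k + γ) * p.coeff k := by
  have e : X * (1 - X) * derivative (derivative p) + (C α + C β * X) * derivative p + C γ * p
      = X * derivative (derivative p) - X * (X * derivative (derivative p)) + C α * derivative p
        + C β * (X * derivative p) + C γ * p := by ring
  rw [e]
  rcases k with _ | _ | k
  · simp [coeff_derivative]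
  · simp [coeff_derivative, coeff_X_mul]; ring
  · simp only [coeff_add, coeff_sub, coeff_X_mul, coeff_C_mul, coeff_derivative]
    push_cast
    ring

lemma hpoly_ode {m : ℕ} (hm : 0 < m) :
    X * (1 - X) * derivative (derivative (hpoly m (m + 1)))
      + (C (-(2 * m : ℚ)) + C (-2 : ℚ) * X) * derivative (hpoly m (m + 1))
      + C ((m * (m + 1) : ℚ)) * hpoly m (m + 1) = 0 := by
  ext k
  rw [ode_coeff, hpoly_coeff, hpoly_coeff, coeff_zero]
  linear_combination hcoef_rec hm ((m : ℚ) + 1) k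

lemma Y_ode {m : ℕ} (P : ℚ[X])
    (h : X * (1 - X) * derivative (derivative P)
      + (C (-(2 * m : ℚ)) + C (-2 : ℚ) * X) * derivative P + C ((m * (m + 1) : ℚ)) * P = 0)
    (hm : 0 < m) :
    X * (1 - X) * derivative (derivative ((1 - X) ^ (2 * m + 1) * P))
      + (C (-(2 * m : ℚ)) + C (4 * m : ℚ) * X) * derivative ((1 - X) ^ (2 * m + 1) * P)
      + C (-(m * (3 * m + 1) : ℚ)) * ((1 - X) ^ (2 * m + 1) * P) = 0 := by
  obtain ⟨r, hr⟩ : ∃ r, 2 * m = r + 1 := ⟨2 * m - 1, by omega⟩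
  have hrm : ((r : ℕ) : ℚ[X]) = 2 * (m : ℚ[X]) - 1 := by
    have := congrArg (Nat.cast : ℕ → ℚ[X]) hr
    push_cast at this
    linear_combination -this
  rw [hr]
  simp only [derivative_mul, derivative_pow, derivative_sub, derivative_one, derivative_X,
    derivative_add, derivative_C, derivative_zero]
  simp only [C_neg, C_mul, C_add, C_1, map_natCast, map_ofNat] at h ⊢
  simp only [Nat.add_sub_cancel, Nat.cast_add, Nat.cast_one, hrm]
  linear_combination (1 - X) ^ (r + 2) * h

lemma pade_explicit {m : ℕ} (hm : 0 < m) :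
    X ^ (2 * m + 1) ∣ hpoly m (-((3 * m + 1 : ℕ) : ℚ))
      - (1 - X) ^ (2 * m + 1) * hpoly m (m + 1) := by
  rw [X_pow_dvd_iff]
  set Y := (1 - X) ^ (2 * m + 1) * hpoly m (m + 1) with hY
  have key : ∀ k : ℕ, ((k : ℚ) + 1) * (k - 2 * m) * Y.coeff (k + 1)
      = (k - m) * (k + -((3 * m + 1 : ℕ) : ℚ)) * Y.coeff k := by
    intro k
    have h := congrArg (fun p => coeff p k) (Y_ode _ (hpoly_ode hm) hm)
    simp only [ode_coeff, coeff_zero] at h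
    push_cast
    linear_combination h
  intro d hd
  rw [coeff_sub, hpoly_coeff, sub_eq_zero]
  induction d with
  | zero =>
    rw [hcoef_zero, coeff_zero_eq_eval_zero, hY]
    simp [hpoly_eval_zero]
  | succ d ih =>
    have h1 := ih (by omega)
    have h2 := key d
    rw [← h1, ← hcoef_rec hm] at h2
    have h3 : (d : ℚ) < 2 * m := by
      have : d < 2 * m := by omega
      exact_mod_cast this
    refine (mul_left_cancel₀ ?_ h2).symm
    exact mul_ne_zero (by positivity) (by linarith)

end explicit

section link
variable {k : Type*} [Field k]

/-- generating polynomial of a vector -/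
def genF (N : ℕ) (w : Fin (N + 1) → k) : k[X] := ∑ i : Fin (N + 1), C (w i) * X ^ (N - (i : ℕ))

lemma genF_natDegree (N : ℕ) (w : Fin (N + 1) → k) : (genF N w).natDegree ≤ N := by
  refine natDegree_sum_le_of_forall_le _ _ fun i _ => ?_
  exact (natDegree_C_mul_X_pow_le _ _).trans (Nat.sub_le _ _)

lemma genF_coeff (N : ℕ) (w : Fin (N + 1) → k) (i : Fin (N + 1)) :
    (genF N w).coeff (N - (i : ℕ)) = w i := by
  unfold genF
  simp only [finsetSum_coeff, coeff_C_mul_X_pow]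
  rw [Finset.sum_eq_single i]
  · simp
  · intro j _ hj
    rw [if_neg]
    intro h
    apply hj
    ext
    omega
  · simp

lemma genF_eval_zero (N : ℕ) (w : Fin (N + 1) → k) : (genF N w).eval 0 = w (Fin.last N) := by
  rw [← coeff_zero_eq_eval_zero, ← genF_coeff N w (Fin.last N)]
  simp

lemma fixed_iff (N : ℕ) (w : Fin (N + 1) → k) :
    (pascalMatrix k N).mulVec w = w ↔
      (1 - X) ^ (N + 1) ∣ genF N w - X ^ (N + 1) * subS N (genF N w) := by
  -- the reflected polynomial
  set G : k[X] := ∑ i : Fin (N + 1), C (w i) * X ^ (i : ℕ) with hG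
  have hGc : ∀ j : Fin (N + 1), G.coeff (j : ℕ) = w j := by
    intro j
    rw [hG]
    simp only [finsetSum_coeff, coeff_C_mul_X_pow]
    rw [Finset.sum_eq_single j]
    · simp
    · intro i _ hi
      rw [if_neg]
      intro h
      exact hi (Fin.ext h.symm)
    · simp
  have hS : subS N (genF N w) = G.comp (1 - X) := by
    unfold genF
    rw [subS_sum, hG, Polynomial.sum_comp]
    refine sum_congr rfl fun i _ => ?_
    rw [subS_C_mul, subS_X_pow _ _ (Nat.sub_le _ _)]
    simp [show N - (N - (i : ℕ)) = i by omega]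
  have inv : ((1 : k[X]) - X).comp (1 - X) = X := by simp
  have step1 : (1 - X) ^ (N + 1) ∣ genF N w - X ^ (N + 1) * subS N (genF N w) ↔
      X ^ (N + 1) ∣ (genF N w).comp (1 - X) - (1 - X) ^ (N + 1) * G := by
    have hGG : (G.comp (1 - X)).comp (1 - X) = G := by
      rw [comp_assoc, inv, comp_X]
    have hFF : ((genF N w).comp (1 - X)).comp (1 - X) = genF N w := by
      rw [comp_assoc, inv, comp_X]
    rw [hS]
    constructor
    · rintro ⟨q, hq⟩
      refine ⟨q.comp (1 - X), ?_⟩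
      have := congrArg (fun p => p.comp (1 - X)) hq
      simpa only [sub_comp, mul_comp, pow_comp, X_comp, one_comp, hGG, sub_sub_cancel] using this
    · rintro ⟨q, hq⟩
      refine ⟨q.comp (1 - X), ?_⟩
      have := congrArg (fun p => p.comp (1 - X)) hq
      simpa only [sub_comp, mul_comp, pow_comp, X_comp, one_comp, hFF, sub_sub_cancel] using this
  rw [step1]
  -- power series
  set V : PowerSeries k := ∑ i : Fin (N + 1),
    PowerSeries.C (w i) * (PowerSeries.mk fun n => (Nat.choose ((i : ℕ) + n) i : k)) with hV
  have hVc : ∀ j : Fin (N + 1), PowerSeries.coeff (j : ℕ) V = (pascalMatrix k N).mulVec w j := by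
    intro j
    rw [hV, map_sum, Matrix.mulVec, dotProduct]
    refine sum_congr rfl fun i _ => ?_
    rw [PowerSeries.coeff_C_mul, PowerSeries.coeff_mk, pascalMatrix, mul_comm, add_comm (i : ℕ),
      Nat.choose_symm_add]
  have hFV : (((genF N w).comp (1 - X) : k[X]) : PowerSeries k)
      = (1 - PowerSeries.X) ^ (N + 1) * V := by
    unfold genF
    rw [Polynomial.sum_comp, hV, mul_sum, ← Polynomial.coeToPowerSeries.ringHom_apply, map_sum]
    refine sum_congr rfl fun i _ => ?_
    have h1 := PowerSeries.mk_add_choose_mul_one_sub_pow_eq_one k (i : ℕ)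
    have h2 : N + 1 = (N - (i : ℕ)) + ((i : ℕ) + 1) := by omega
    have h3 : (1 - PowerSeries.X : PowerSeries k) ^ (N + 1)
        = (1 - PowerSeries.X) ^ (N - (i : ℕ)) * (1 - PowerSeries.X) ^ ((i : ℕ) + 1) := by
      rw [← pow_add, ← h2]
    rw [h3]
    simp
    linear_combination (-PowerSeries.C (w i) * (1 - PowerSeries.X) ^ (N - (i : ℕ))) * h1
  have step2 : X ^ (N + 1) ∣ (genF N w).comp (1 - X) - (1 - X) ^ (N + 1) * G ↔
      (PowerSeries.X : PowerSeries k) ^ (N + 1) ∣ (1 - PowerSeries.X) ^ (N + 1) * (V - (G : PowerSeries k)) := by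
    rw [X_pow_dvd_iff, PowerSeries.X_pow_dvd_iff]
    have e : (1 - PowerSeries.X) ^ (N + 1) * (V - (G : PowerSeries k))
        = (((genF N w).comp (1 - X) - (1 - X) ^ (N + 1) * G : k[X]) : PowerSeries k) := by
      rw [mul_sub, ← hFV]
      simp
    rw [e]
    simp only [Polynomial.coeff_coe]
  have hu : IsUnit ((1 - PowerSeries.X : PowerSeries k) ^ (N + 1)) := by
    apply IsUnit.pow
    exact IsUnit.of_mul_eq_one_right _ (PowerSeries.mk_one_mul_one_sub_eq_one k)
  rw [step2, hu.dvd_mul_left, PowerSeries.X_pow_dvd_iff]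
  constructor
  · intro h j hj
    have := congrFun h ⟨j, hj⟩
    rw [← hVc, ← hGc] at this
    simp only [map_sub, Polynomial.coeff_coe]
    exact sub_eq_zero.2 this
  · intro h
    ext j
    have := h j j.2
    rw [map_sub, Polynomial.coeff_coe, hVc, hGc] at this
    exact sub_eq_zero.1 this

lemma exists_genF (N : ℕ) (f : k[X]) (hf : f.natDegree ≤ N) :
    genF N (fun i => f.coeff (N - (i : ℕ))) = f := by
  unfold genF
  rw [Fin.sum_univ_eq_sum_range (fun i => C (f.coeff (N - i)) * X ^ (N - i)) (N + 1),
    f.as_sum_range_C_mul_X_pow' (n := N + 1) (by omega)]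
  have := Finset.sum_range_reflect (fun i => C (f.coeff i) * X ^ i) (N + 1)
  rw [← f.as_sum_range_C_mul_X_pow' (n := N + 1) (by omega)] at this ⊢
  simpa using this

end link

theorem stmt0 (N : ℕ) (hN : 0 < N) (heven : Even N) :
    ∃ v : Fin (N + 1) → ℚ,
      (pascalMatrix ℚ N).mulVec v = v ∧
      v (Fin.last N) = 1 ∧
      (∑ k : Fin (N + 1), C (v k) * X ^ (N - (k : ℕ))) = Ppoly N * Qpoly N ∧
      ∀ w : Fin (N + 1) → ℂ, (pascalMatrix ℂ N).mulVec w = w →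
        w (Fin.last N) = 1 → w = fun k => (v k : ℂ) := by
  obtain ⟨m, rfl⟩ : ∃ m, N = 2 * m := heven.two_dvd
  have hm : 0 < m := by omega
  have hP : Ppoly (2 * m) = hpoly m (m + 1) := by
    unfold Ppoly hpoly
    simp [Pcoef_eq]
  have hQ : Qpoly (2 * m) = hpoly m (-((3 * m + 1 : ℕ) : ℚ)) := by
    unfold Qpoly hpoly
    simp only [Qcoef_eq]
    simp
  have hb : (0 : ℚ) < m + 1 := by positivity
  obtain ⟨B, hB⟩ := padeSys_of hm (pade_explicit hm)
    (hpoly_natDegree (poch_neg_ne (by omega))) (hpoly_natDegree (poch_pos hb m).ne')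
    (hpoly_eval_zero _ _) (hpoly_eval_zero _ _) (hpoly_eval_one hb)
  rw [← hP, ← hQ] at hB
  have hdeg : (Ppoly (2 * m) * Qpoly (2 * m)).natDegree ≤ 2 * m := by
    refine natDegree_mul_le.trans ?_
    rw [hB.dA, hB.dC]; omega
  have hgen := exists_genF (2 * m) _ hdeg
  set v : Fin (2 * m + 1) → ℚ :=
    fun i => (Ppoly (2 * m) * Qpoly (2 * m)).coeff (2 * m - (i : ℕ)) with hv
  refine ⟨v, ?_, ?_, hgen, ?_⟩
  · rw [fixed_iff, hgen]
    exact hB.exists_fixed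
  · rw [← genF_eval_zero (2 * m) v, hgen]
    simp [hB.A0, hB.C0]
  · intro w hw hw1
    have hBC := hB.map (algebraMap ℚ ℂ)
    have hu := hBC.unique hm (F := genF (2 * m) w) (genF_natDegree _ _)
      (by rw [genF_eval_zero, hw1]) ((fixed_iff _ _).1 hw)
    funext i
    rw [← genF_coeff _ w i, hu, ← Polynomial.map_mul, coeff_map]
    simp [hv]
end
end

section
/- Let N be a natural number, v ∈ ℂ^{N+1}, and λ ∈ ℂ. Then T_N v = λ v if and only if for every z ∈ ℂ with |z − 1| < 1 one has (1/(2π)) ∫_{−∞}^{∞} f(v; 1/2 + it) / [(1/2+it)^{N+1} (1/2−it)^{N+1} (1 − z + z(1/2+it))] dt = λ f(v; z), where the integral converges absolutely and the denominator never vanishes for |z−1| < 1. (Via the parametrization w = 1/2 + it this is the contour integral (1/(2πi)) ∫_{Re(w)=1/2} f(v; w)/(w^{N+1}(1−w)^{N+1}(1−z+zw)) dw over the critical line.) -/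
open Complex MeasureTheory

noncomputable section

/-- The generating function `f(v; z) = ∑_{k=0}^N v_k z^{N-k}`. -/
def genFun {N : ℕ} (v : Fin (N + 1) → ℂ) (z : ℂ) : ℂ :=
  ∑ k : Fin (N + 1), v k * z ^ (N - (k : ℕ))

/-- The integrand `f(v; 1/2+it) / ((1/2+it)^{N+1} (1/2-it)^{N+1} (1-z+z(1/2+it)))`
of the contour integral over the critical line, parametrized by `w = 1/2 + it`. -/
def critIntegrand (N : ℕ) (v : Fin (N + 1) → ℂ) (z : ℂ) (t : ℝ) : ℂ :=
  genFun v (1 / 2 + (t : ℂ) * I) /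
    ((1 / 2 + (t : ℂ) * I) ^ (N + 1) * (1 / 2 - (t : ℂ) * I) ^ (N + 1) *
      (1 - z + z * (1 / 2 + (t : ℂ) * I)))

/-- `1/w` on the critical line. -/
def px (t : ℝ) : ℂ := (1 / 2 + (t : ℂ) * I)⁻¹
/-- `1/(1-w)` on the critical line. -/
def py (t : ℝ) : ℂ := (1 / 2 - (t : ℂ) * I)⁻¹
/-- `1/(1-z+zw)` on the critical line. -/
def ps (z : ℂ) (t : ℝ) : ℂ := (1 - z + z * (1 / 2 + (t : ℂ) * I))⁻¹

lemma line_ne {c : ℂ} (hc : 0 < c.re) (t : ℝ) : c + (t : ℂ) * I ≠ 0 := by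
  intro h
  have := congrArg Complex.re h
  simp at this
  linarith

lemma p_ne (t : ℝ) : (1 / 2 + (t : ℂ) * I) ≠ 0 := line_ne (by norm_num) t

lemma q_ne (t : ℝ) : (1 / 2 - (t : ℂ) * I) ≠ 0 := by
  have := p_ne (-t)
  simpa [sub_eq_add_neg] using this

lemma disc_ne {z : ℂ} (hz : ‖z - 1‖ < 1) : z ≠ 0 := by
  rintro rfl
  simp at hz

lemma disc_re {z : ℂ} (hz : ‖z - 1‖ < 1) : 0 < (z⁻¹ - 1 / 2).re := by
  have h0 := disc_ne hz
  have hn : 0 < normSq z := normSq_pos.2 h0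
  have h1 : normSq (z - 1) < 1 := by
    rw [normSq_eq_norm_sq]
    nlinarith [norm_nonneg (z - 1)]
  have h2 : normSq z < 2 * z.re := by
    simp only [normSq_apply, sub_re, sub_im, one_re, one_im] at h1 ⊢
    linarith
  have : (z⁻¹ - 1 / 2).re = z.re / normSq z - 1 / 2 := by
    simp
  rw [this, sub_pos, lt_div_iff₀ hn]
  linarith

lemma r_eq {z : ℂ} (h0 : z ≠ 0) (t : ℝ) :
    1 - z + z * (1 / 2 + (t : ℂ) * I) = z * ((z⁻¹ - 1 / 2) + (t : ℂ) * I) := by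
  field_simp
  ring

lemma r_ne {z : ℂ} (hz : ‖z - 1‖ < 1) (t : ℝ) : 1 - z + z * (1 / 2 + (t : ℂ) * I) ≠ 0 := by
  rw [r_eq (disc_ne hz)]
  exact mul_ne_zero (disc_ne hz) (line_ne (disc_re hz) t)

lemma xy_rel (t : ℝ) : px t * py t = px t + py t := by
  have h1 := p_ne t
  have h2 := q_ne t
  unfold px py
  have e : (1 / 2 - (t : ℂ) * I) = 1 - (1 / 2 + (t : ℂ) * I) := by ring
  rw [e] at h2 ⊢
  generalize (1 / 2 + (t : ℂ) * I) = P at *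
  field_simp
  ring

lemma ys_rel {z : ℂ} (hz : ‖z - 1‖ < 1) (t : ℝ) : py t * ps z t = py t + z * ps z t := by
  have h1 := r_ne hz t
  have h2 := q_ne t
  unfold ps py
  rw [← mul_inv, eq_comm, ← mul_left_inj' (mul_ne_zero h2 h1), inv_mul_cancel₀ (mul_ne_zero h2 h1)]
  rw [add_mul, ← mul_assoc, inv_mul_cancel₀ h2]
  have : z * (1 - z + z * (1 / 2 + (t : ℂ) * I))⁻¹ * ((1 / 2 - (t : ℂ) * I) * (1 - z + z * (1 / 2 + (t : ℂ) * I))) = z * (1 / 2 - (t : ℂ) * I) * ((1 - z + z * (1 / 2 + (t : ℂ) * I))⁻¹ * (1 - z + z * (1 / 2 + (t : ℂ) * I))) := by ring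
  rw [this, inv_mul_cancel₀ h1]
  ring

lemma xs_rel {z : ℂ} (hz : ‖z - 1‖ < 1) (t : ℝ) :
    (1 - z) * (px t * ps z t) = px t - z * ps z t := by
  have h1 := r_ne hz t
  have h2 := p_ne t
  unfold ps px
  generalize (1 / 2 + (t : ℂ) * I) = P at *
  generalize hR : 1 - z + z * P = R at *
  field_simp
  linear_combination hR

lemma x_cont : Continuous px := by
  unfold px
  exact Continuous.inv₀ (by fun_prop) p_ne

lemma y_cont : Continuous py := by
  unfold py
  exact Continuous.inv₀ (by fun_prop) q_ne

lemma s_cont {z : ℂ} (hz : ‖z - 1‖ < 1) : Continuous (ps z) := by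
  unfold ps
  exact Continuous.inv₀ (by fun_prop) (r_ne hz)

lemma x_sq (t : ℝ) : ‖px t‖ ^ 2 = (1 / 4 + t ^ 2)⁻¹ := by
  unfold px
  rw [norm_inv, inv_pow, ← normSq_eq_norm_sq, normSq_apply]
  simp
  ring

lemma y_norm (t : ℝ) : ‖py t‖ = ‖px t‖ := by
  unfold px py
  rw [norm_inv, norm_inv, ← Complex.norm_conj]
  congr 2
  apply Complex.ext <;> simp

lemma x_le (t : ℝ) : ‖px t‖ ≤ 2 := by
  have h := x_sq t
  have : (1 / 4 + t ^ 2)⁻¹ ≤ 4 := by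
    rw [inv_le_comm₀ (by positivity) (by norm_num)]
    nlinarith [sq_nonneg t]
  nlinarith [norm_nonneg (px t)]

lemma x_sq_le (t : ℝ) : ‖px t‖ ^ 2 ≤ 4 * (1 + t ^ 2)⁻¹ := by
  rw [x_sq, ← div_eq_mul_inv, inv_le_comm₀ (by positivity) (by positivity), inv_div,
    div_le_iff₀ (by norm_num)]
  nlinarith [sq_nonneg t]

lemma s_le {z : ℂ} (hz : ‖z - 1‖ < 1) : ∃ C : ℝ, 0 ≤ C ∧ ∀ t, ‖ps z t‖ ≤ C * ‖px t‖ := by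
  have h0 := disc_ne hz
  set c := z⁻¹ - 1 / 2 with hc
  have hd : 0 < c.re := disc_re hz
  refine ⟨‖z⁻¹‖ * (1 + ‖1 / 2 - c‖ * c.re⁻¹), by positivity, fun t => ?_⟩
  have hl := line_ne hd t
  have hp := p_ne t
  have e : ps z t = z⁻¹ * (1 + (1 / 2 - c) * (c + t * I)⁻¹) * px t := by
    unfold ps px
    rw [r_eq h0, ← hc]
    have hc' : (1 / 2 : ℂ) - c = (1 / 2 + (t : ℂ) * I) - (c + t * I) := by ring
    rw [hc']
    generalize (1 / 2 + (t : ℂ) * I) = P at *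
    generalize c + (t : ℂ) * I = R at *
    field_simp
    ring
  rw [e, norm_mul, norm_mul]
  gcongr
  refine (norm_add_le _ _).trans ?_
  rw [norm_one, norm_mul, norm_inv]
  gcongr
  have := Complex.re_le_norm (c + t * I)
  simpa using this

lemma integrable_of_bd {f : ℝ → ℂ} (hf : Continuous f) (C : ℝ)
    (h : ∀ t, ‖f t‖ ≤ C * ‖px t‖ ^ 2) : Integrable f := by
  have hi : Integrable (fun t : ℝ => |C| * (4 * (1 + t ^ 2)⁻¹)) :=
    (integrable_inv_one_add_sq.const_mul 4).const_mul _
  refine hi.mono' hf.aestronglyMeasurable (Filter.Eventually.of_forall fun t => ?_)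
  refine (h t).trans ?_
  exact mul_le_mul (le_abs_self C) (x_sq_le t) (by positivity) (abs_nonneg C)

lemma xpow_le (n : ℕ) (t : ℝ) : ‖px t‖ ^ (n + 2) ≤ 2 ^ n * ‖px t‖ ^ 2 := by
  rw [pow_add]
  gcongr
  exact x_le t

lemma K_int (a b : ℕ) (h : 2 ≤ a + b) : Integrable (fun t => px t ^ a * py t ^ b) := by
  obtain ⟨n, hn⟩ := Nat.exists_eq_add_of_le' h
  refine integrable_of_bd ((x_cont.pow a).mul (y_cont.pow b)) (2 ^ n) fun t => ?_
  rw [norm_mul, norm_pow, norm_pow, y_norm, ← pow_add, hn]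
  exact xpow_le n t

lemma J_int {z : ℂ} (hz : ‖z - 1‖ < 1) (a b : ℕ) (h : 1 ≤ a + b) :
    Integrable (fun t => px t ^ a * py t ^ b * ps z t) := by
  obtain ⟨n, hn⟩ := Nat.exists_eq_add_of_le' h
  obtain ⟨C, hC, hs⟩ := s_le hz
  refine integrable_of_bd (((x_cont.pow a).mul (y_cont.pow b)).mul (s_cont hz)) (C * 2 ^ n)
    fun t => ?_
  rw [norm_mul, norm_mul, norm_pow, norm_pow, y_norm, ← pow_add, hn]
  calc ‖px t‖ ^ (n + 1) * ‖ps z t‖ ≤ ‖px t‖ ^ (n + 1) * (C * ‖px t‖) := by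
        gcongr
        exact hs t
    _ = C * ‖px t‖ ^ (n + 2) := by ring
    _ ≤ C * (2 ^ n * ‖px t‖ ^ 2) := by
        gcongr
        exact xpow_le n t
    _ = _ := by ring

open Filter Topology in
lemma inv_lim (c : ℂ) {l : Filter ℝ} (hl : Tendsto (fun t : ℝ => |t|) l atTop) :
    Tendsto (fun t : ℝ => (c + (t : ℂ) * I)⁻¹) l (𝓝 0) := by
  refine tendsto_inv₀_cobounded.comp ?_
  rw [← tendsto_norm_atTop_iff_cobounded]
  refine tendsto_atTop_mono (f := fun t : ℝ => |t| + -‖c‖) (fun t => ?_)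
    (tendsto_atTop_add_const_right _ _ hl)
  have := norm_sub_le (c + (t : ℂ) * I) c
  simp at this
  linarith

lemma line_deriv (c : ℂ) (t : ℝ) : HasDerivAt (fun t : ℝ => c + (t : ℂ) * I) I t := by
  have h : HasDerivAt (fun t : ℝ => (t : ℂ)) 1 t := Complex.ofRealCLM.hasDerivAt
  simpa using (h.mul_const I).const_add c

lemma x_deriv (t : ℝ) : HasDerivAt px (-I * px t ^ 2) t := by
  have := (line_deriv (1 / 2) t).inv (p_ne t)
  refine this.congr_deriv ?_
  unfold px
  rw [inv_pow, div_eq_mul_inv]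

lemma K_zero_right (a : ℕ) : ∫ t, px t ^ (a + 2) = 0 := by
  have hd : ∀ t, HasDerivAt (fun t => I / (a + 1) * px t ^ (a + 1)) (px t ^ (a + 2)) t := by
    intro t
    have := ((x_deriv t).pow (a + 1)).const_mul (I / (a + 1))
    refine this.congr_deriv ?_
    have h : (a : ℂ) + 1 ≠ 0 := by exact_mod_cast Nat.succ_ne_zero a
    have h2 : I / ((a : ℂ) + 1) * ((a : ℂ) + 1) = I := div_mul_cancel₀ _ h
    push_cast
    have h3 : a + 1 - 1 = a := by omega
    try rw [h3]
    linear_combination (-I * px t ^ (a + 2)) * h2 - px t ^ (a + 2) * I_mul_I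
  have hlim : ∀ l : Filter ℝ, Filter.Tendsto (fun t : ℝ => |t|) l Filter.atTop →
      Filter.Tendsto (fun t => I / (a + 1) * px t ^ (a + 1)) l (nhds 0) := by
    intro l hl
    have := ((inv_lim (1 / 2) hl).pow (a + 1)).const_mul (I / (a + 1))
    rw [zero_pow (Nat.succ_ne_zero a), mul_zero] at this
    exact this
  have hi := K_int (a + 2) 0 (by omega)
  simp only [pow_zero, mul_one] at hi
  have := integral_of_hasDerivAt_of_tendsto hd hi (hlim _ Filter.tendsto_abs_atBot_atTop)
    (hlim _ Filter.tendsto_abs_atTop_atTop)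
  simpa using this

lemma K_zero_left (b : ℕ) : ∫ t, py t ^ (b + 2) = 0 := by
  rw [← K_zero_right b, ← integral_neg_eq_self]
  congr 1
  ext t
  simp [px, py]

lemma K_one : ∫ t, px t * py t = 2 * (Real.pi : ℂ) := by
  have e : ∀ t : ℝ, px t * py t = ((4 * (1 + (2 * t) ^ 2)⁻¹ : ℝ) : ℂ) := by
    intro t
    have h : (1 + (2 * (t : ℂ)) ^ 2) ≠ 0 := by
      have : (1 + (2 * t) ^ 2 : ℝ) ≠ 0 := by positivity
      exact_mod_cast this
    unfold px py
    push_cast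
    rw [← mul_inv, ← div_eq_mul_inv, inv_eq_iff_eq_inv, inv_div]
    ring_nf
    simp
  simp_rw [e]
  rw [integral_complex_ofReal, integral_const_mul,
    Measure.integral_comp_mul_left (fun x : ℝ => (1 + x ^ 2)⁻¹) 2, integral_univ_inv_one_add_sq]
  push_cast
  simp
  ring

lemma K_rec (a b : ℕ) (h : 1 ≤ a + b) : ∫ t, px t ^ (a + 1) * py t ^ (b + 1) =
    (∫ t, px t ^ (a + 1) * py t ^ b) + ∫ t, px t ^ a * py t ^ (b + 1) := by
  rw [← integral_add (K_int _ _ (by omega)) (K_int _ _ (by omega))]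
  congr 1
  ext t
  linear_combination (px t ^ a * py t ^ b) * xy_rel t

lemma K_val (a b : ℕ) : ∫ t, px t ^ (a + 1) * py t ^ (b + 1) =
    2 * (Real.pi : ℂ) * (Nat.choose (a + b) b : ℂ) := by
  induction a generalizing b with
  | zero =>
    induction b with
    | zero => simpa using K_one
    | succ b ih =>
      rw [K_rec _ _ (by omega), ih]
      have := K_zero_left b
      simp [this]
  | succ a iha =>
    induction b with
    | zero =>
      rw [K_rec _ _ (by omega), iha]
      have := K_zero_right a
      simp [this]
    | succ b ih =>
      rw [K_rec _ _ (by omega), ih, iha]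
      have : (a + 1 + (b + 1)).choose (b + 1) = (a + 1 + b).choose b + (a + (b + 1)).choose (b + 1) := by
        have : a + 1 + (b + 1) = (a + 1 + b) + 1 := by ring
        rw [this, Nat.choose_succ_succ]
        congr 2
        ring
      rw [this]
      push_cast
      ring

lemma slit {c : ℂ} (hc : 0 < c.re) (t : ℝ) :
    (1 / 2 + (t : ℂ) * I) / (c + (t : ℂ) * I) ∈ slitPlane := by
  by_contra h
  set u := (1 / 2 + (t : ℂ) * I) / (c + (t : ℂ) * I) with hu
  have hl := line_ne hc t
  rw [mem_slitPlane_iff] at h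
  push Not at h
  have e : u * (c + (t : ℂ) * I) = 1 / 2 + (t : ℂ) * I := div_mul_cancel₀ _ hl
  have := congrArg Complex.re e
  simp [h.2] at this
  nlinarith [h.1]

lemma J_one_aux {c : ℂ} (hc : 0 < c.re) (hne : c ≠ 1 / 2)
    (hi : Integrable (fun t : ℝ => px t * (c + (t : ℂ) * I)⁻¹)) :
    ∫ t : ℝ, px t * (c + (t : ℂ) * I)⁻¹ = 0 := by
  have hne' : c - 1 / 2 ≠ 0 := sub_ne_zero.2 hne
  have hd : ∀ t : ℝ, HasDerivAt
      (fun t : ℝ => (I * (c - 1 / 2))⁻¹ * Complex.log ((1 / 2 + (t : ℂ) * I) / (c + (t : ℂ) * I)))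
      (px t * (c + (t : ℂ) * I)⁻¹) t := by
    intro t
    have h1 := (line_deriv (1 / 2) t).div (line_deriv c t) (line_ne hc t)
    have h2 := (h1.clog_real (slit hc t)).const_mul ((I * (c - 1 / 2))⁻¹)
    refine h2.congr_deriv ?_
    have hl := line_ne hc t
    have hp := p_ne t
    unfold px
    simp only [Pi.div_apply]
    rw [inv_mul_eq_div, div_eq_iff (mul_ne_zero I_ne_zero hne'), div_eq_iff (div_ne_zero hp hl)]
    generalize hP : (1 / 2 + (t : ℂ) * I) = P at *
    have hc' : c + (t : ℂ) * I = P + (c - 1 / 2) := by rw [← hP]; ring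
    rw [hc'] at hl ⊢
    generalize c - 1 / 2 = D at *
    field_simp
    ring
  have hlim : ∀ l : Filter ℝ, Filter.Tendsto (fun t : ℝ => |t|) l Filter.atTop →
      Filter.Tendsto (fun t : ℝ => (I * (c - 1 / 2))⁻¹ *
        Complex.log ((1 / 2 + (t : ℂ) * I) / (c + (t : ℂ) * I))) l (nhds 0) := by
    intro l hl
    have h1 : Filter.Tendsto (fun t : ℝ => (1 / 2 + (t : ℂ) * I) / (c + (t : ℂ) * I)) l
        (nhds 1) := by
      have := ((inv_lim c hl).const_mul (1 / 2 - c)).const_add 1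
      simp only [mul_zero, add_zero] at this
      refine this.congr fun t => ?_
      have := line_ne hc t
      field_simp
      ring
    have h2 := (h1.clog (by simp)).const_mul ((I * (c - 1 / 2))⁻¹)
    simpa using h2
  have := integral_of_hasDerivAt_of_tendsto hd hi (hlim _ Filter.tendsto_abs_atBot_atTop)
    (hlim _ Filter.tendsto_abs_atTop_atTop)
  simpa using this

lemma J_zero {z : ℂ} (hz : ‖z - 1‖ < 1) (a : ℕ) : ∫ t, px t ^ (a + 1) * ps z t = 0 := by
  by_cases h1 : z = 1
  · subst h1
    rw [← K_zero_right a]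
    congr 1
    ext t
    have : ps 1 t = px t := by simp [ps, px]
    rw [this]
    ring
  · have h0 := disc_ne hz
    induction a with
    | zero =>
      have e : ∀ t, px t ^ (0 + 1) * ps z t =
          z⁻¹ * (px t * ((z⁻¹ - 1 / 2) + (t : ℂ) * I)⁻¹) := by
        intro t
        rw [ps, r_eq h0, mul_inv]
        ring
      have hi := J_int hz 1 0 (by omega)
      have hi2 : Integrable (fun t : ℝ => px t * ((z⁻¹ - 1 / 2) + (t : ℂ) * I)⁻¹) := by
        refine (hi.const_mul z).congr (Filter.Eventually.of_forall fun t => ?_)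
        have := e t
        simp only [zero_add] at this
        simp only [pow_zero, mul_one]
        rw [this, mul_inv_cancel_left₀ h0]
      simp_rw [e]
      rw [integral_const_mul, J_one_aux (disc_re hz) _ hi2, mul_zero]
      intro h
      apply h1
      have : z⁻¹ = 1 := by linear_combination h
      simpa using this
    | succ a ih =>
      have hz1 : 1 - z ≠ 0 := sub_ne_zero.2 (Ne.symm h1)
      have hk := K_int (a + 2) 0 (by omega)
      have hj := J_int hz (a + 1) 0 (by omega)
      simp only [pow_zero, mul_one] at hk hj
      have e : ∀ t, px t ^ (a + 1 + 1) * ps z t =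
          (1 - z)⁻¹ * (px t ^ (a + 2) - z * (px t ^ (a + 1) * ps z t)) := by
        intro t
        rw [eq_inv_mul_iff_mul_eq₀ hz1]
        linear_combination px t ^ (a + 1) * xs_rel hz t
      simp_rw [e]
      rw [integral_const_mul, integral_sub hk (hj.const_mul z), integral_const_mul, ih,
        K_zero_right]
      simp

lemma J_val {z : ℂ} (hz : ‖z - 1‖ < 1) (a b : ℕ) :
    ∫ t, px t ^ (a + 1) * py t ^ b * ps z t =
      2 * (Real.pi : ℂ) * ∑ j ∈ Finset.range b, (Nat.choose (a + j) j : ℂ) * z ^ (b - 1 - j) := by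
  induction b with
  | zero => simpa using J_zero hz a
  | succ b ih =>
    have e : ∀ t, px t ^ (a + 1) * py t ^ (b + 1) * ps z t =
        px t ^ (a + 1) * py t ^ (b + 1) + z * (px t ^ (a + 1) * py t ^ b * ps z t) := by
      intro t
      linear_combination px t ^ (a + 1) * py t ^ b * ys_rel hz t
    simp_rw [e]
    rw [integral_add (K_int _ _ (by omega)) ((J_int hz _ _ (by omega)).const_mul z),
      integral_const_mul, ih, K_val, Finset.sum_range_succ]
    have : ∑ j ∈ Finset.range b, (Nat.choose (a + j) j : ℂ) * z ^ (b + 1 - 1 - j) =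
        z * ∑ j ∈ Finset.range b, (Nat.choose (a + j) j : ℂ) * z ^ (b - 1 - j) := by
      rw [Finset.mul_sum]
      refine Finset.sum_congr rfl fun j hj => ?_
      have hj := Finset.mem_range.1 hj
      have : b + 1 - 1 - j = (b - 1 - j) + 1 := by omega
      rw [this]
      ring
    rw [this]
    simp
    ring

lemma crit_eq (N : ℕ) (v : Fin (N + 1) → ℂ) (z : ℂ) (t : ℝ) :
    critIntegrand N v z t =
      ∑ k : Fin (N + 1), v k * (px t ^ ((k : ℕ) + 1) * py t ^ (N + 1) * ps z t) := by
  unfold critIntegrand genFun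
  rw [div_eq_mul_inv, Finset.sum_mul]
  refine Finset.sum_congr rfl fun k _ => ?_
  have hp := p_ne t
  rw [mul_inv, mul_inv, ← inv_pow, ← inv_pow]
  change v k * (1 / 2 + (t : ℂ) * I) ^ (N - (k : ℕ)) * (px t ^ (N + 1) * py t ^ (N + 1) * ps z t) = _
  have h : N + 1 = (N - (k : ℕ)) + ((k : ℕ) + 1) := by omega
  have h2 : px t ^ (N + 1) = px t ^ (N - (k : ℕ)) * px t ^ ((k : ℕ) + 1) := by
    rw [← pow_add, ← h]
  have h3 : (1 / 2 + (t : ℂ) * I) ^ (N - (k : ℕ)) * px t ^ (N - (k : ℕ)) = 1 := by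
    rw [← mul_pow, px, mul_inv_cancel₀ hp, one_pow]
  rw [h2]
  linear_combination (v k * px t ^ ((k : ℕ) + 1) * py t ^ (N + 1) * ps z t) * h3

lemma crit_val (N : ℕ) (v : Fin (N + 1) → ℂ) {z : ℂ} (hz : ‖z - 1‖ < 1) :
    (1 / (2 * Real.pi) : ℝ) • ∫ t : ℝ, critIntegrand N v z t =
      genFun ((pascalMatrix ℂ N).mulVec v) z := by
  simp_rw [crit_eq]
  rw [integral_finsetSum _ fun k _ => (J_int hz _ _ (by omega)).const_mul _]
  simp_rw [integral_const_mul, J_val hz]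
  have hpi : (Real.pi : ℂ) ≠ 0 := by exact_mod_cast Real.pi_ne_zero
  rw [real_smul, Finset.mul_sum]
  unfold genFun Matrix.mulVec dotProduct pascalMatrix
  simp_rw [Finset.sum_mul]
  rw [Finset.sum_comm]
  refine Finset.sum_congr rfl fun k _ => ?_
  rw [← Fin.sum_univ_eq_sum_range (fun j => (Nat.choose ((k : ℕ) + j) j : ℂ) * z ^ (N + 1 - 1 - j))]
  have : ∀ S : ℂ, ((1 / (2 * Real.pi) : ℝ) : ℂ) * (v k * (2 * (Real.pi : ℂ) * S)) = v k * S := by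
    intro S
    push_cast
    field_simp
  rw [this, Finset.mul_sum]
  refine Finset.sum_congr rfl fun j _ => ?_
  rw [add_comm (k : ℕ) j]
  simp
  ring

lemma genFun_inj {N : ℕ} (u : Fin (N + 1) → ℂ)
    (h : ∀ z : ℂ, ‖z - 1‖ < 1 → genFun u z = 0) : u = 0 := by
  let P : Polynomial ℂ := ∑ k : Fin (N + 1), Polynomial.monomial (N - (k : ℕ)) (u k)
  have hP : ∀ z, P.eval z = genFun u z := by
    intro z
    simp [P, genFun, Polynomial.eval_finsetSum]
  have hP0 : P = 0 := by
    apply Polynomial.eq_zero_of_infinite_isRoot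
    have hinf : (Metric.ball (1 : ℂ) 1).Infinite :=
      infinite_of_mem_nhds (1 : ℂ) (Metric.ball_mem_nhds _ one_pos)
    refine hinf.mono fun z hz => ?_
    rw [Set.mem_ofPred_eq, Polynomial.IsRoot, hP]
    exact h z (by simpa [dist_eq_norm] using hz)
  ext k
  have := congrArg (fun p => Polynomial.coeff p (N - (k : ℕ))) hP0
  simp only [P, Polynomial.finsetSum_coeff, Polynomial.coeff_monomial, Polynomial.coeff_zero] at this
  rw [Finset.sum_eq_single k] at this
  · simpa using this
  · intro j _ hj
    rw [if_neg]
    intro h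
    apply hj
    ext
    omega
  · simp

theorem stmt3 (N : ℕ) (v : Fin (N + 1) → ℂ) (lam : ℂ) :
    (∀ z : ℂ, ‖z - 1‖ < 1 →
      (∀ t : ℝ, (1 / 2 + (t : ℂ) * I) ^ (N + 1) * (1 / 2 - (t : ℂ) * I) ^ (N + 1) *
          (1 - z + z * (1 / 2 + (t : ℂ) * I)) ≠ 0) ∧
      Integrable (fun t : ℝ => critIntegrand N v z t)) ∧
    ((pascalMatrix ℂ N).mulVec v = lam • v ↔
      ∀ z : ℂ, ‖z - 1‖ < 1 →
        (1 / (2 * Real.pi) : ℝ) • ∫ t : ℝ, critIntegrand N v z t = lam * genFun v z) := by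
  refine ⟨fun z hz => ⟨fun t => ?_, ?_⟩, ?_⟩
  · exact mul_ne_zero (mul_ne_zero (pow_ne_zero _ (p_ne t)) (pow_ne_zero _ (q_ne t))) (r_ne hz t)
  · simp_rw [crit_eq]
    exact integrable_finsetSum _ fun k _ => (J_int hz _ _ (by omega)).const_mul _
  · have hs : ∀ z, genFun (lam • v) z = lam * genFun v z := by
      intro z
      simp [genFun, Finset.mul_sum, mul_assoc]
    constructor
    · intro h z hz
      rw [crit_val N v hz, h, hs]
    · intro h
      rw [← sub_eq_zero]
      apply genFun_inj
      intro z hz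
      have h1 := h z hz
      rw [crit_val N v hz, ← hs] at h1
      rw [← sub_eq_zero] at h1
      rw [← h1]
      simp [genFun, sub_mul, Finset.sum_sub_distrib]
end
end

section
/- Let N be a positive even integer. Then μ = (N² + 2N)/2 is an eigenvalue of J_N, and every vector v ∈ ℂ^{N+1} with J_N v = ((N²+2N)/2) v satisfies T_N v = v; that is, the eigenspace of J_N for eigenvalue (N²+2N)/2 is nonzero and is contained in the eigenspace of T_N for eigenvalue 1. -/
noncomputable section

/-- Off-diagonal entry `a(n) = (N+1)²n - n³` of the Jacobi matrix `J_N`. -/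
def aEnt (N n : ℕ) : ℂ := ((N : ℂ) + 1) ^ 2 * (n : ℂ) - (n : ℂ) ^ 3

/-- Diagonal entry `b(n) = 2n³ + 3n² + 2n - (N+1)²n` of the Jacobi matrix `J_N`. -/
def bEnt (N n : ℕ) : ℂ :=
  2 * (n : ℂ) ^ 3 + 3 * (n : ℂ) ^ 2 + 2 * (n : ℂ) - ((N : ℂ) + 1) ^ 2 * (n : ℂ)

/-- The `(N+1) × (N+1)` tridiagonal matrix `J_N`, with `(J_N)_{n,n} = b(n)` and
`(J_N)_{n,n-1} = (J_N)_{n-1,n} = a(n)`. -/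
def jacobiMatrix (N : ℕ) : Matrix (Fin (N + 1)) (Fin (N + 1)) ℂ :=
  fun m n =>
    if (m : ℕ) = (n : ℕ) then bEnt N (m : ℕ)
    else if (m : ℕ) + 1 = (n : ℕ) then aEnt N (n : ℕ)
    else if (n : ℕ) + 1 = (m : ℕ) then aEnt N (m : ℕ)
    else 0

lemma jac_symm (N : ℕ) (m n : Fin (N+1)) : jacobiMatrix N m n = jacobiMatrix N n m := by
  unfold jacobiMatrix
  split_ifs <;> first | rfl | omega | simp_all

lemma aEnt_last (N : ℕ) : aEnt N (N+1) = 0 := by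
  unfold aEnt; push_cast; ring

lemma aEnt_zero (N : ℕ) : aEnt N 0 = 0 := by
  unfold aEnt; push_cast; ring

lemma aEnt_ne (N n : ℕ) (h : n < N) : aEnt N (n+1) ≠ 0 := by
  have : aEnt N (n+1) = ((n+1 : ℕ) : ℂ) * ((N - n : ℕ) : ℂ) * ((N + n + 2 : ℕ) : ℂ) := by
    rw [Nat.cast_sub h.le]; unfold aEnt; push_cast; ring
  rw [this]
  refine mul_ne_zero (mul_ne_zero ?_ ?_) ?_ <;> rw [Nat.cast_ne_zero] <;> omega

/-- Row sums against the tridiagonal matrix. -/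
lemma jac_sum (N : ℕ) (f : ℕ → ℂ) (k : Fin (N+1)) :
    ∑ m : Fin (N+1), jacobiMatrix N k m * f m =
      bEnt N k * f k + aEnt N k * f ((k:ℕ) - 1) + aEnt N (k+1) * f (k+1) := by
  obtain ⟨k, hk⟩ := k
  have h1 : ∀ m : Fin (N+1), jacobiMatrix N ⟨k, hk⟩ m * f m =
      (fun m : ℕ => (if k = m then bEnt N k * f k else 0) +
        (if k + 1 = m then aEnt N (k+1) * f (k+1) else 0) +
        (if m + 1 = k then aEnt N k * f (k-1) else 0)) m := by
    rintro ⟨m, hm⟩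
    simp only [jacobiMatrix]
    by_cases e1 : k = m
    · subst e1; simp
    by_cases e2 : k + 1 = m
    · subst e2; simp; intro h; omega
    by_cases e3 : m + 1 = k
    · subst e3; simp [e2]
    simp [e1, e2, e3]
  rw [Finset.sum_congr rfl (fun m _ => h1 m),
    Fin.sum_univ_eq_sum_range (fun m : ℕ => (if k = m then bEnt N k * f k else 0) +
        (if k + 1 = m then aEnt N (k+1) * f (k+1) else 0) +
        (if m + 1 = k then aEnt N k * f (k-1) else 0)) (N+1),
    Finset.sum_add_distrib, Finset.sum_add_distrib, Finset.sum_ite_eq, Finset.sum_ite_eq]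
  have h2 : (if k + 1 ∈ Finset.range (N+1) then aEnt N (k+1) * f (k+1) else 0) =
      aEnt N (k+1) * f (k+1) := by
    split_ifs with h
    · rfl
    · have : k = N := by simp at h; omega
      subst this; simp [aEnt_last]
  have h3 : (∑ m ∈ Finset.range (N+1), if m + 1 = k then aEnt N k * f (k-1) else 0) =
      aEnt N k * f (k-1) := by
    cases k with
    | zero => simp [aEnt_zero]
    | succ k =>
      simp only [Nat.add_right_cancel_iff, Finset.sum_ite_eq']
      rw [if_pos (by simp; omega)]
  rw [h2, h3, if_pos (by simpa using hk)]
  ring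

/-- The binomial transform on natural indices. -/
def bEntry (j k : ℕ) : ℂ := (-1) ^ k * (Nat.choose j k : ℂ)

def bMat (N : ℕ) : Matrix (Fin (N+1)) (Fin (N+1)) ℂ := fun j k => bEntry j k

lemma choose_rel (j k : ℕ) :
    ((k : ℂ) + 1) * (Nat.choose j (k+1) : ℂ) = ((j : ℂ) - k) * (Nat.choose j k : ℂ) := by
  rcases le_or_gt k j with h | h
  · have := Nat.choose_succ_right_eq j k
    have h2 := congrArg (Nat.cast : ℕ → ℂ) this
    push_cast [Nat.cast_sub h] at h2
    linear_combination h2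
  · rw [Nat.choose_eq_zero_of_lt h, Nat.choose_eq_zero_of_lt (by omega)]; simp

lemma choose_rel2 (j k : ℕ) :
    (j : ℂ) * (Nat.choose (j-1) k : ℂ) = ((j : ℂ) - k) * (Nat.choose j k : ℂ) := by
  cases j with
  | zero => cases k <;> simp
  | succ j =>
    have h1 := choose_rel (j+1) k
    have h2 := congrArg (Nat.cast : ℕ → ℂ) (Nat.add_one_mul_choose_eq j k)
    push_cast at h1 h2 ⊢
    try simp only [Nat.add_sub_cancel]
    linear_combination h1 + h2

lemma key_nat (N j k : ℕ) :
    (bEnt N k * bEntry j k + aEnt N k * bEntry j (k-1) + aEnt N (k+1) * bEntry j (k+1)) +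
    (bEnt N j * bEntry j k + aEnt N j * bEntry (j-1) k + aEnt N (j+1) * bEntry (j+1) k) =
    ((N:ℂ)^2 + 2*N) * bEntry j k := by
  have h1 := choose_rel j k
  have h2 := choose_rel2 j k
  cases k with
  | zero =>
    simp only [bEntry, aEnt, bEnt] at *
    simp at *
    linear_combination ((j:ℂ)^2 - ((N:ℂ)+1)^2) * 0
  | succ k =>
    have h3 := choose_rel j k
    have h4 : (Nat.choose (j+1) (k+1) : ℂ) = Nat.choose j k + Nat.choose j (k+1) := by
      rw [Nat.choose_succ_succ]; push_cast; ring
    simp only [bEntry, aEnt, bEnt, h4, Nat.add_sub_cancel]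
    push_cast at *
    simp only [pow_succ]
    linear_combination (-1:ℂ)^k * ((((N:ℂ)+1)^2 - (k+2)^2) * h1 - (((N:ℂ)+1)^2 - j^2) * h2
      + (((N:ℂ)+1)^2 - ((k+1)^2+(k+1)*(j+1)+(j+1)^2)) * h3)

lemma key_mat (N : ℕ) : bMat N * jacobiMatrix N + jacobiMatrix N * bMat N =
    ((N:ℂ)^2 + 2*N) • bMat N := by
  ext j k
  have e1 := jac_sum N (fun m => bEntry j m) k
  have e2 := jac_sum N (fun m => bEntry m k) j
  simp only [Matrix.add_apply, Matrix.mul_apply, Matrix.smul_apply, smul_eq_mul]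
  rw [show ∑ m, bMat N j m * jacobiMatrix N m k = ∑ m : Fin (N+1), jacobiMatrix N k m * bEntry j m
    from Finset.sum_congr rfl (fun m _ => by rw [jac_symm N m k, mul_comm]; rfl)]
  exact (congrArg₂ (· + ·) e1 e2).trans (key_nat N j k)

lemma pascal_eq (N : ℕ) : pascalMatrix ℂ N = bMat N * (bMat N).transpose := by
  ext ⟨i, hi⟩ ⟨j, hj⟩
  simp only [Matrix.mul_apply, Matrix.transpose_apply, pascalMatrix, bMat, bEntry]
  have : ∀ m : Fin (N+1), (-1 : ℂ)^(m:ℕ) * (Nat.choose i m : ℂ) * ((-1)^(m:ℕ) * (Nat.choose j m : ℂ)) =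
    (fun m : ℕ => (Nat.choose i m : ℂ) * (Nat.choose j m : ℂ)) m := by
    intro m
    have : (-1 : ℂ)^(m:ℕ) * (-1 : ℂ)^(m:ℕ) = 1 := by rw [← mul_pow]; simp
    linear_combination (Nat.choose i m : ℂ) * (Nat.choose j m : ℂ) * this
  rw [Finset.sum_congr rfl (fun m _ => this m),
    Fin.sum_univ_eq_sum_range (fun m : ℕ => (Nat.choose i m : ℂ) * (Nat.choose j m : ℂ)) (N+1)]
  have h : (i+j).choose i = ∑ m ∈ Finset.range (i+1), i.choose m * j.choose m := by
    rw [Nat.add_choose_eq, Finset.Nat.sum_antidiagonal_eq_sum_range_succ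
      (fun a b => i.choose a * j.choose b), ← Finset.sum_range_reflect]
    refine Finset.sum_congr rfl fun m hm => ?_
    have hm' : m ≤ i := by simpa [Nat.lt_succ_iff] using hm
    have q : i + 1 - 1 - m = i - m := by omega
    rw [q, Nat.choose_symm hm', Nat.sub_sub_self hm']
  rw [h]; push_cast
  refine Finset.sum_subset (by intro x; simp; omega) ?_
  intro x _ hx
  rw [Nat.choose_eq_zero_of_lt (by simpa using hx)]; simp

lemma eig_zero (N : ℕ) (μ : ℂ) (v : Fin (N+1) → ℂ) (hv : (jacobiMatrix N).mulVec v = μ • v)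
    (h0 : v 0 = 0) : v = 0 := by
  let f : ℕ → ℂ := fun m => if h : m < N+1 then v ⟨m, h⟩ else 0
  have hf : ∀ m : Fin (N+1), f m = v m := fun m => dif_pos m.2
  have hrow : ∀ k : Fin (N+1),
      bEnt N k * f k + aEnt N k * f ((k:ℕ) - 1) + aEnt N (k+1) * f (k+1) = μ * f k := by
    intro k
    rw [← jac_sum N f k, hf k]
    simp only [hf]
    exact congrFun hv k
  have hz : ∀ n, n < N+1 → f n = 0 := by
    intro n
    induction n using Nat.strong_induction_on with
    | _ n ih =>
      intro hn
      cases n with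
      | zero => exact (hf 0).trans h0
      | succ n =>
        have := hrow ⟨n, by omega⟩
        simp only at this
        rw [ih n (by omega) (by omega), ih (n-1) (by omega) (by omega)] at this
        simpa [aEnt_ne N n (by omega)] using this
  ext m
  rw [← hf m, hz m m.2]; rfl

lemma bMat_det (N : ℕ) : (bMat N).det ≠ 0 := by
  rw [Matrix.det_of_isLowerTriangular]
  · refine Finset.prod_ne_zero_iff.2 fun i _ => ?_
    simp [bMat, bEntry]
  · intro i j hij
    have : (i:ℕ) < j := by simpa using hij
    simp [bMat, bEntry, Nat.choose_eq_zero_of_lt this]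

lemma jac_transpose (N : ℕ) : (jacobiMatrix N).transpose = jacobiMatrix N := by
  ext i j; exact jac_symm N j i

open Matrix in
lemma swap_eig (N : ℕ) (A : Matrix (Fin (N+1)) (Fin (N+1)) ℂ) (c : ℂ)
    (h : A * jacobiMatrix N + jacobiMatrix N * A = c • A) (v : Fin (N+1) → ℂ)
    (hv : (jacobiMatrix N).mulVec v = (c/2) • v) :
    (jacobiMatrix N).mulVec (A.mulVec v) = (c/2) • A.mulVec v := by
  have := congrArg (fun M => M.mulVec v) h
  simp only [add_mulVec, ← mulVec_mulVec, hv, mulVec_smul, smul_mulVec] at this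
  rw [← eq_sub_iff_add_eq'] at this
  rw [this, ← sub_smul]; congr 1; ring

lemma eig_prop (N : ℕ) (μ : ℂ) (v w : Fin (N+1) → ℂ) (hv : (jacobiMatrix N).mulVec v = μ • v)
    (hw : (jacobiMatrix N).mulVec w = μ • w) : v 0 • w = w 0 • v := by
  rw [← sub_eq_zero]
  refine eig_zero N μ _ ?_ ?_
  · rw [Matrix.mulVec_sub, Matrix.mulVec_smul, Matrix.mulVec_smul, hv, hw, smul_sub,
      smul_comm μ, smul_comm μ]
  · simp [mul_comm]

open scoped ComplexOrder in
lemma star_dot_zero {n : ℕ} (v : Fin n → ℂ) (h : dotProduct (star v) v = 0) : v = 0 :=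
  dotProduct_star_self_eq_zero.1 h

theorem stmt10 (N : ℕ) (hN : 0 < N) (heven : Even N) :
    (∃ v : Fin (N + 1) → ℂ, v ≠ 0 ∧
      (jacobiMatrix N).mulVec v = (((N : ℂ) ^ 2 + 2 * N) / 2) • v) ∧
    ∀ v : Fin (N + 1) → ℂ,
      (jacobiMatrix N).mulVec v = (((N : ℂ) ^ 2 + 2 * N) / 2) • v →
      (pascalMatrix ℂ N).mulVec v = v := by
  constructor
  · let M := jacobiMatrix N - (((N : ℂ) ^ 2 + 2 * N) / 2) • (1 : Matrix _ _ ℂ)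
    have hM : bMat N * M = -(M * bMat N) := by
      simp only [M, mul_sub, sub_mul, Matrix.mul_smul, Matrix.smul_mul, mul_one, one_mul]
      rw [eq_neg_iff_add_eq_zero, sub_add_sub_comm, key_mat, ← add_smul, ← sub_smul]
      convert zero_smul ℂ _ using 2; ring
    have hd := congrArg Matrix.det hM
    rw [Matrix.det_neg, Matrix.det_mul, Matrix.det_mul, Fintype.card_fin,
      (heven.add_one).neg_one_pow] at hd
    have h2 : M.det = 0 := by
      have : (bMat N).det * M.det = 0 := by linear_combination hd / 2
      exact (mul_eq_zero.1 this).resolve_left (bMat_det N)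
    obtain ⟨v, hv0, hv⟩ := Matrix.exists_mulVec_eq_zero_iff.2 h2
    refine ⟨v, hv0, ?_⟩
    simpa [M, Matrix.sub_mulVec, Matrix.smul_mulVec, sub_eq_zero] using hv
  · intro v hv
    by_cases hv0 : v 0 = 0
    · rw [eig_zero N _ v hv hv0, Matrix.mulVec_zero]
    have h1 := eig_prop N _ v _ hv (swap_eig N _ _ (key_mat N) v hv)
    have hB0 : (bMat N).mulVec v 0 = v 0 := by
      simp [Matrix.mulVec, dotProduct, bMat, bEntry, Fin.sum_univ_succ]
    have hB : (bMat N).mulVec v = v := by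
      rw [hB0] at h1
      exact smul_right_injective _ hv0 h1
    have hkt : (bMat N).transpose * jacobiMatrix N + jacobiMatrix N * (bMat N).transpose =
        ((N:ℂ)^2 + 2*N) • (bMat N).transpose := by
      have := congrArg Matrix.transpose (key_mat N)
      simp only [Matrix.transpose_add, Matrix.transpose_mul, jac_transpose,
        Matrix.transpose_smul] at this
      exact (add_comm _ _).trans this
    have h3 := eig_prop N _ v _ hv (swap_eig N _ _ hkt v hv)
    have hBs : (bMat N).mulVec (star v) = star v := by
      have := congrArg star hB
      refine Eq.trans ?_ this
      ext i
      simp [Matrix.mulVec, dotProduct, bMat, bEntry]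
    have h4 : dotProduct (star v) ((bMat N).transpose.mulVec v) = dotProduct (star v) v := by
      rw [Matrix.dotProduct_mulVec, Matrix.vecMul_transpose, hBs]
    have h5 : dotProduct (star v) v ≠ 0 := by
      intro h
      exact hv0 (by rw [star_dot_zero v h]; rfl)
    have h6 : (bMat N).transpose.mulVec v 0 = v 0 := by
      have := congrArg (dotProduct (star v)) h3
      rw [dotProduct_smul, dotProduct_smul, h4] at this
      exact (mul_right_cancel₀ h5 this).symm
    have hBt : (bMat N).transpose.mulVec v = v := by
      rw [h6] at h3
      exact smul_right_injective _ hv0 h3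
    rw [pascal_eq, ← Matrix.mulVec_mulVec, hBt, hB]
end
end
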